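/- For the tree T constructed from a Σ₁-correct approximation (σ_s) of a 1-generic A <_T 0′ with distinguished path C: if U is a recursive subtree of T with C ∈ [U], then the set V = { s : some τ ∈ T \ U has τ^d = σ_s } is finite, and consequently [T] \ [U] is finite and [U] = [T] ∩ N for some clopen N. Hence [T] is a thin Π⁰₁ class. -/

import Mathlib

/-- Finite binary strings. -/
abbrev BStr := List Bool

/-- The length-`k` initial segment of an infinite sequence, as a finite string. -/
def seg {α : Type} (A : ℕ → α) (k : ℕ) : List α := (List.range k).map A

/-- A Σ⁰₁ (r.e.) set of binary strings. -/
def Sigma01 (V : Set BStr) : Prop :=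
  ∃ f : BStr → ℕ → Bool, Computable₂ f ∧ ∀ σ, σ ∈ V ↔ ∃ n, f σ n = true

/-- A Σ⁰₂ set of binary strings. -/
def Sigma02 (V : Set BStr) : Prop :=
  ∃ f : BStr → ℕ × ℕ → Bool, Computable₂ f ∧ ∀ σ, σ ∈ V ↔ ∃ m, ∀ n, f σ (m, n) = true

/-- `A` meets the set of strings `V`. -/
def Meets (A : ℕ → Bool) (V : Set BStr) : Prop := ∃ k, seg A k ∈ V

/-- `A` avoids the set of strings `V`. -/
def Avoids (A : ℕ → Bool) (V : Set BStr) : Prop := ∃ k, ∀ τ, seg A k <+: τ → τ ∉ V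

/-- `A` is 1-generic. -/
def OneGeneric (A : ℕ → Bool) : Prop := ∀ V, Sigma01 V → Meets A V ∨ Avoids A V

/-- `A` is 2-generic. -/
def TwoGeneric (A : ℕ → Bool) : Prop := ∀ V, Sigma02 V → Meets A V ∨ Avoids A V

/-- A Turing functional: a computable, oracle-use-monotone map from finite oracle
strings to partial values. -/
structure Functional (α β : Type) [Primcodable α] [Primcodable β] where
  φ : List α → ℕ → Option β
  comp : Computable₂ φ
  mono : ∀ {σ τ : List α} {x : ℕ} {b : β}, σ <+: τ → φ σ x = some b → φ τ x = some b

/-- `Φ^A = B` (in particular `Φ^A` is total). -/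
def FunApplies {α β : Type} [Primcodable α] [Primcodable β]
    (Φ : Functional α β) (A : ℕ → α) (B : ℕ → β) : Prop :=
  ∀ x, ∃ k, Φ.φ (seg A k) x = some (B x)

/-- Turing reducibility `B ≤_T A`. -/
def TuringLE {α β : Type} [Primcodable α] [Primcodable β] (B : ℕ → β) (A : ℕ → α) : Prop :=
  ∃ Φ : Functional α β, FunApplies Φ A B

/-- Turing equivalence `B ≡_T A`. -/
def TuringEquiv {α β : Type} [Primcodable α] [Primcodable β] (B : ℕ → β) (A : ℕ → α) : Prop :=
  TuringLE B A ∧ TuringLE A B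

/-- A tree: a set of strings closed under initial segments. -/
def IsTree {α : Type} (T : Set (List α)) : Prop := ∀ σ τ : List α, σ <+: τ → τ ∈ T → σ ∈ T

/-- A recursive tree. -/
def RecTree {α : Type} [Primcodable α] (T : Set (List α)) : Prop :=
  IsTree T ∧ ∃ f : List α → Bool, Computable f ∧ ∀ σ, σ ∈ T ↔ f σ = true

/-- Every string on the tree has a proper extension on the tree. -/
def ExtendibleTree {α : Type} (T : Set (List α)) : Prop :=
  ∀ σ ∈ T, ∃ τ ∈ T, σ <+: τ ∧ σ ≠ τ

/-- The set `[T]` of infinite paths through the tree `T`. -/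
def paths {α : Type} (T : Set (List α)) : Set (ℕ → α) := {X | ∀ k, seg X k ∈ T}

/-- A clopen subset of the path space: a finite union of basic cylinders. -/
def ClopenC {α : Type} (N : Set (ℕ → α)) : Prop :=
  ∃ F : Finset (List α), N = {X | ∃ σ ∈ F, seg X σ.length = σ}

/-- A Π⁰₁ class: the set of paths through a recursive tree. -/
def Pi01C {α : Type} [Primcodable α] (P : Set (ℕ → α)) : Prop := ∃ T, RecTree T ∧ P = paths T

/-- A thin Π⁰₁ class: every Π⁰₁ subclass is the intersection with a clopen set. -/
def ThinPi01 {α : Type} [Primcodable α] (P : Set (ℕ → α)) : Prop :=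
  Pi01C P ∧ ∀ Q, Pi01C Q → Q ⊆ P → ∃ N, ClopenC N ∧ Q = P ∩ N

/-- `A` is of thin-free degree: no set Turing equivalent to `A` belongs to a thin Π⁰₁ class. -/
def ThinFreeDegree (A : ℕ → Bool) : Prop :=
  ∀ B : ℕ → Bool, TuringEquiv B A → ∀ P : Set (ℕ → Bool), ThinPi01 P → B ∉ P

open Classical in
/-- The halting problem `0′`. -/
noncomputable def K : ℕ → Bool := fun n =>
  if (Nat.Partrec.Code.eval (Denumerable.ofNat Nat.Partrec.Code n) n).Dom then true else false

/-- A recursive (limit-lemma) approximation of `A`. -/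
def RecApprox (σs : ℕ → BStr) (A : ℕ → Bool) : Prop :=
  Computable σs ∧ ∀ n, ∃ s0, ∀ s ≥ s0, (σs s).take n = seg A n

/-- `τ` is an initial segment of `A`. -/
def InitSegOf {α : Type} (τ : List α) (A : ℕ → α) : Prop := τ = seg A τ.length

/-- A recursively enumerable set of natural numbers. -/
def REset (S : Set ℕ) : Prop :=
  ∃ f : ℕ → ℕ → Bool, Computable₂ f ∧ ∀ s, s ∈ S ↔ ∃ n, f s n = true

/-- A Σ₁-correct approximation: every infinite r.e. set of stages contains a stage
whose approximating string is a true initial segment of `A`. -/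
def SigmaOneCorrect (σs : ℕ → BStr) (A : ℕ → Bool) : Prop :=
  ∀ S : Set ℕ, REset S → S.Infinite → ∃ s ∈ S, InitSegOf (σs s) A

/-- The three-letter alphabet `{0,1,B}`: `none` is the blank symbol `B`. -/
abbrev Sym3 := Option Bool

/-- Delete all blanks `B` from a string over `{0,1,B}`. -/
def delB (τ : List Sym3) : BStr := τ.filterMap id

/-- The level-marker function `l(s)` of the construction:
`l(0)=0`, `l(1)=|σ_0|+1`, `l(s+2)=l(s+1)+|σ_{s+1}|-|σ_s|`. -/
def lvl (σs : ℕ → BStr) : ℕ → ℕ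
  | 0 => 0
  | 1 => (σs 0).length + 1
  | (s+2) => lvl σs (s+1) + ((σs (s+1)).length - (σs s).length)

/-- The stage during which level `n` of the tree is constructed:
the `s` with `l(s) ≤ n < l(s+1)`. -/
def stg (σs : ℕ → BStr) (n : ℕ) : ℕ :=
  ((List.range (n + 2)).filter (fun s => lvl σs (s + 1) ≤ n)).length

/-- The tree `T ⊆ {0,1,B}^{<ω}` constructed from the approximation `(σ_s)`:
a string `τ` at a level built during stage `s` whose `B`-deleted part is an
initial segment of `σ_s` gets both children `0` and `1`; all other strings are
extended only by the blank `B`. -/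
inductive TreeT (σs : ℕ → BStr) : List Sym3 → Prop
  | nil : TreeT σs []
  | ext (τ : List Sym3) (a : Sym3) : TreeT σs τ →
      (if delB τ <+: σs (stg σs τ.length) then a ≠ none else a = none) →
      TreeT σs (τ ++ [a])

theorem seg_length' {α : Type} (X : ℕ → α) (k : ℕ) : (seg X k).length = k := by simp [seg]

theorem seg_succ' {α : Type} (X : ℕ → α) (k : ℕ) : seg X (k + 1) = seg X k ++ [X k] := by
  simp [seg, List.range_succ]

theorem seg_take' {α : Type} (X : ℕ → α) {j k : ℕ} (h : j ≤ k) : (seg X k).take j = seg X j := by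
  simp [seg, List.take_range, ← List.map_take, h]

theorem seg_prefix' {α : Type} (X : ℕ → α) {j k : ℕ} (h : j ≤ k) : seg X j <+: seg X k := by
  rw [← seg_take' X h]; exact List.take_prefix _ _

theorem eq_seg_of_prefix' {α : Type} {X : ℕ → α} {τ : List α} {k : ℕ} (h : τ <+: seg X k) :
    τ = seg X τ.length := by
  have hl := h.length_le
  rw [seg_length'] at hl
  rw [← seg_take' X hl]
  exact List.prefix_iff_eq_take.1 h

theorem seg_inj' {α : Type} {X Y : ℕ → α} {k : ℕ} (h : seg X k = seg Y k) {i : ℕ} (hi : i < k) :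
    X i = Y i := by
  have := congrArg (fun l => l[i]?) h
  simpa [seg, hi] using this

theorem delB_append' (τ ρ : List Sym3) : delB (τ ++ ρ) = delB τ ++ delB ρ := by
  simp [delB, List.filterMap_append]

theorem delB_prefix' {τ ρ : List Sym3} (h : τ <+: ρ) : delB τ <+: delB ρ := by
  obtain ⟨t, rfl⟩ := h
  rw [delB_append']; exact List.prefix_append _ _

theorem delB_length' (τ : List Sym3) : (delB τ).length ≤ τ.length := List.length_filterMap_le _ _

theorem treeT_snoc (σs : ℕ → BStr) (τ : List Sym3) (a : Sym3) :
    TreeT σs (τ ++ [a]) ↔ TreeT σs τ ∧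
      (if delB τ <+: σs (stg σs τ.length) then a ≠ none else a = none) := by
  constructor
  · intro h
    generalize hρ : τ ++ [a] = ρ at h
    cases h with
    | nil => simp at hρ
    | ext τ' a' h1 h2 =>
      obtain ⟨rfl, h⟩ := List.append_inj' hρ rfl
      simp only [List.cons.injEq, and_true] at h
      subst h
      exact ⟨h1, h2⟩
  · rintro ⟨h1, h2⟩
    exact TreeT.ext τ a h1 h2

theorem treeT_isTree (σs : ℕ → BStr) : IsTree {τ : List Sym3 | TreeT σs τ} := by
  rintro σ τ ⟨t, rfl⟩ h
  induction t using List.reverseRecOn with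
  | nil => simpa using h
  | append_singleton t a ih =>
    apply ih
    rw [← List.append_assoc] at h
    exact ((treeT_snoc σs _ a).1 h).1

/-! ### Computability of the tree -/

theorem lvl_succ' (σs : ℕ → BStr) (hinc : ∀ s, (σs s).length < (σs (s + 1)).length) (s : ℕ) :
    lvl σs (s + 1) = (σs s).length + 1 := by
  induction s with
  | zero => rfl
  | succ s ih =>
    have := hinc s
    rw [lvl, ih]; omega

theorem lvl_mono' (σs : ℕ → BStr) {s t : ℕ} (h : s ≤ t) : lvl σs (s + 1) ≤ lvl σs (t + 1) := by
  induction t, h using Nat.le_induction with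
  | base => exact le_rfl
  | succ t _ ih => rw [lvl]; omega

theorem stg_large (σs : ℕ → BStr) (s0 : ℕ) : ∃ M, ∀ n ≥ M, s0 ≤ stg σs n := by
  refine ⟨s0 + lvl σs (s0 + 1), fun n hn => ?_⟩
  have h1 : (List.range s0).Sublist (List.range (n + 2)) :=
    List.range_sublist.2 (by omega)
  have h2 := h1.filter (fun s => decide (lvl σs (s + 1) ≤ n))
  have h3 : (List.range s0).filter (fun s => decide (lvl σs (s + 1) ≤ n)) = List.range s0 := by
    rw [List.filter_eq_self]
    intro a ha
    have := lvl_mono' σs (le_of_lt (List.mem_range.1 ha))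
    simp; omega
  have h4 := h2.length_le
  rw [h3] at h4
  simpa [stg] using h4

theorem stg_computable (σs : ℕ → BStr) (hc : Computable σs)
    (hinc : ∀ s, (σs s).length < (σs (s + 1)).length) : Computable (stg σs) := by
  have hle : Computable₂ (fun a b : ℕ => decide (a ≤ b)) := Primrec.nat_le.decide.to_comp
  have hlen : Computable (fun s => (σs s).length + 1) :=
    Computable.succ.comp (Computable.list_length.comp hc)
  have hh : Computable₂ (fun (n : ℕ) (p : ℕ × ℕ) =>
      cond (decide ((σs p.1).length + 1 ≤ n)) (p.2 + 1) p.2) := by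
    refine Computable.cond ?_ ?_ ?_
    · exact hle.comp (hlen.comp (Computable.fst.comp Computable.snd)) Computable.fst
    · exact Computable.succ.comp (Computable.snd.comp Computable.snd)
    · exact Computable.snd.comp Computable.snd
  have := Computable.nat_rec (f := fun n : ℕ => n + 2) (g := fun _ : ℕ => (0 : ℕ))
    (Computable.succ.comp Computable.succ) (Computable.const 0) hh
  refine this.of_eq fun n => ?_
  have key : ∀ m : ℕ, Nat.rec (motive := fun _ => ℕ) 0 (fun y IH =>
      cond (decide ((σs y).length + 1 ≤ n)) (IH + 1) IH) m =
      ((List.range m).filter (fun s => lvl σs (s + 1) ≤ n)).length := ?_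
  · exact key (n + 2)
  intro m
  induction m with
  | zero => simp
  | succ m ih =>
    rw [List.range_succ, List.filter_append, List.length_append, ← ih]
    by_cases h : (σs m).length + 1 ≤ n
    · have : (σs m).length < n := h
      simp [lvl_succ' σs hinc, this]
    · have : ¬ (σs m).length < n := h
      simp [lvl_succ' σs hinc, this]

/-- One-step decision procedure for the tree. -/
def condB (σs : ℕ → BStr) (τ : List Sym3) (i : ℕ) : Bool :=
  decide (decide ((σs (stg σs i)).take (delB (τ.take i)).length = delB (τ.take i)) =
    !(decide (τ[i]? = some none)))

theorem condB_append (σs : ℕ → BStr) (τ : List Sym3) (a : Sym3) {i : ℕ} (hi : i < τ.length) :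
    condB σs (τ ++ [a]) i = condB σs τ i := by
  simp only [condB]
  rw [List.take_append_of_le_length hi.le, List.getElem?_append_left hi]

theorem condB_last (σs : ℕ → BStr) (τ : List Sym3) (a : Sym3) :
    condB σs (τ ++ [a]) τ.length = true ↔
      (if delB τ <+: σs (stg σs τ.length) then a ≠ none else a = none) := by
  simp only [condB]
  have hp : decide ((σs (stg σs τ.length)).take (delB τ).length = delB τ) = true ↔
      delB τ <+: σs (stg σs τ.length) := by
    rw [decide_eq_true_eq, List.prefix_iff_eq_take, eq_comm]
  rw [List.take_left, List.getElem?_concat_length]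
  by_cases h : delB τ <+: σs (stg σs τ.length)
  · rw [hp.2 h, if_pos h]; cases a <;> simp
  · rw [Bool.eq_false_iff.2 (fun h' => h (hp.1 h')), if_neg h]; cases a <;> simp

theorem treeT_iff_condB (σs : ℕ → BStr) (τ : List Sym3) :
    TreeT σs τ ↔ ∀ i < τ.length, condB σs τ i = true := by
  induction τ using List.reverseRecOn with
  | nil => simp [TreeT.nil]
  | append_singleton τ a ih =>
    rw [treeT_snoc, ih, ← condB_last]
    constructor
    · rintro ⟨h1, h2⟩ i hi
      rw [List.length_append, List.length_singleton] at hi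
      rcases Nat.lt_succ_iff_lt_or_eq.1 hi with h | rfl
      · rw [condB_append _ _ _ h]; exact h1 i h
      · exact h2
    · intro h
      refine ⟨fun i hi => ?_, h _ (by simp)⟩
      rw [← condB_append σs τ a hi]; exact h i (by simp; omega)

theorem decEq_computable (α : Type) [Primcodable α] [DecidableEq α] :
    Computable₂ (fun a b : α => decide (a = b)) := Primrec.eq.decide.to_comp

theorem delB_computable : Computable delB :=
  (Primrec.listFilterMap Primrec.id Primrec.snd.to₂ : Primrec fun l : List Sym3 => _).to_comp

theorem condB_computable (σs : ℕ → BStr) (hc : Computable σs)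
    (hinc : ∀ s, (σs s).length < (σs (s + 1)).length) : Computable₂ (condB σs) := by
  have hst := stg_computable σs hc hinc
  have hd : Computable (fun p : List Sym3 × ℕ => delB (p.1.take p.2)) :=
    delB_computable.comp
      ((Primrec.list_take.comp Primrec.snd Primrec.fst).to_comp)
  have hb : Computable (fun p : List Sym3 × ℕ =>
      decide ((σs (stg σs p.2)).take (delB (p.1.take p.2)).length = delB (p.1.take p.2))) :=
    (decEq_computable (List Bool)).comp
      (Primrec.list_take.to_comp.comp (Computable.list_length.comp hd)
        (hc.comp (hst.comp Computable.snd))) hd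
  have hn : Computable (fun p : List Sym3 × ℕ => !(decide (p.1[p.2]? = some none))) :=
    Primrec.not.to_comp.comp ((decEq_computable (Option (Option Bool))).comp
      (Computable.list_getElem?) (Computable.const _))
  exact (decEq_computable Bool).comp hb hn

theorem treeT_rec (σs : ℕ → BStr) (hc : Computable σs)
    (hinc : ∀ s, (σs s).length < (σs (s + 1)).length) : RecTree {τ : List Sym3 | TreeT σs τ} := by
  refine ⟨treeT_isTree σs, fun τ => Nat.rec (motive := fun _ => Bool) true
    (fun i b => b && condB σs τ i) τ.length, ?_, ?_⟩
  · refine Computable.nat_rec (f := fun τ : List Sym3 => τ.length) (g := fun _ => true)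
      (h := fun τ p => p.2 && condB σs τ p.1) Computable.list_length (Computable.const _) ?_
    exact Primrec.and.to_comp.comp (Computable.snd.comp Computable.snd)
      ((condB_computable σs hc hinc).comp Computable.fst (Computable.fst.comp Computable.snd))
  · intro τ
    change TreeT σs τ ↔ _
    rw [treeT_iff_condB]
    have key : ∀ m : ℕ, (∀ i < m, condB σs τ i = true) ↔ Nat.rec (motive := fun _ => Bool) true
      (fun i b => b && condB σs τ i) m = true := ?_
    · exact key _
    intro m
    induction m with
    | zero => simp
    | succ m ih =>
      simp only [Bool.and_eq_true]
      rw [← ih]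
      constructor
      · intro h; exact ⟨fun i hi => h i (by omega), h m (by omega)⟩
      · rintro ⟨h1, h2⟩ i hi
        rcases Nat.lt_succ_iff_lt_or_eq.1 hi with h | rfl
        · exact h1 i h
        · exact h2

theorem recTree_inter {T U : Set (List Sym3)} (hT : RecTree T) (hU : RecTree U) :
    RecTree (T ∩ U) := by
  obtain ⟨hT1, f, hf, hfT⟩ := hT
  obtain ⟨hU1, g, hg, hgU⟩ := hU
  refine ⟨fun σ τ h hτ => ⟨hT1 σ τ h hτ.1, hU1 σ τ h hτ.2⟩, fun τ => f τ && g τ,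
    Primrec.and.to_comp.comp hf hg, fun σ => ?_⟩
  rw [Bool.and_eq_true, ← hfT, ← hgU]; rfl

theorem sigma01_diff {T U : Set (List Sym3)} (hT : RecTree T) (hU : RecTree U) :
    Sigma01 {ρ | ∃ τ, τ ∈ T ∧ τ ∉ U ∧ delB τ = ρ} := by
  obtain ⟨hT1, f, hf, hfT⟩ := hT
  obtain ⟨hU1, g, hg, hgU⟩ := hU
  have hk : Computable₂ (fun (p : BStr × ℕ) (τ : List Sym3) =>
      (f τ && (!(g τ))) && decide (delB τ = p.1)) :=
    Primrec.and.to_comp.comp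
      (Primrec.and.to_comp.comp (hf.comp Computable.snd)
        (Primrec.not.to_comp.comp (hg.comp Computable.snd)))
      ((decEq_computable (List Bool)).comp (delB_computable.comp Computable.snd)
        (Computable.fst.comp Computable.fst))
  have hk2 : Computable (fun p : BStr × ℕ => ((Encodable.decode (α := List Sym3) p.2).map
      (fun τ => (f τ && (!(g τ))) && decide (delB τ = p.1))).getD false) :=
    Computable.option_getD
      (Computable.option_map (Computable.decode.comp Computable.snd) hk) (Computable.const false)
  refine ⟨fun ρ n => ((Encodable.decode (α := List Sym3) n).map
      (fun τ => (f τ && (!(g τ))) && decide (delB τ = ρ))).getD false, hk2, fun ρ => ?_⟩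
  constructor
  · rintro ⟨τ, h1, h2, h3⟩
    refine ⟨Encodable.encode τ, ?_⟩
    rw [hfT] at h1; rw [hgU] at h2
    simp [h1, h2, h3]
  · rintro ⟨n, hn⟩
    cases hd : Encodable.decode (α := List Sym3) n with
    | none => simp [hd] at hn
    | some τ =>
      simp only [hd, Option.map_some, Option.getD_some, Bool.and_eq_true, decide_eq_true_eq,
        Bool.not_eq_true'] at hn
      refine ⟨τ, (hfT τ).2 hn.1.1, ?_, hn.2⟩
      rw [hgU, hn.1.2]; simp

/-! ### Combinatorics of the tree -/

theorem clopen_of_level (P : Set (ℕ → Sym3)) (Q : Set (ℕ → Sym3)) (hQP : Q ⊆ P) (m : ℕ)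
    (h : ∀ X ∈ P, ∀ Y ∈ P, seg X m = seg Y m → X ∈ Q → Y ∈ Q) :
    ∃ N, ClopenC N ∧ Q = P ∩ N := by
  classical
  have hfin : {τ : List Sym3 | τ.length = m ∧ ∃ X ∈ Q, seg X m = τ}.Finite :=
    (List.finite_length_eq Sym3 m).subset fun τ hτ => hτ.1
  refine ⟨_, ⟨hfin.toFinset, rfl⟩, ?_⟩
  ext Y
  simp only [Set.mem_inter_iff, Set.mem_ofPred_eq, Set.Finite.mem_toFinset]
  constructor
  · intro hY
    exact ⟨hQP hY, seg Y m, ⟨seg_length' _ _, Y, hY, rfl⟩, by rw [seg_length']⟩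
  · rintro ⟨hY, σ, ⟨hl, X, hX, hXs⟩, hYs⟩
    rw [hl, ← hXs] at hYs
    exact h X (hQP hX) Y hY hYs.symm hX

section main
variable {A : ℕ → Bool} {σs : ℕ → BStr} {C : ℕ → Sym3}

theorem delB_C (hCd : ∀ n : ℕ, ∃ k : ℕ, delB (seg C k) = seg A n) (m : ℕ) :
    delB (seg C m) = seg A (delB (seg C m)).length := by
  obtain ⟨k, hk⟩ := hCd (m + 1)
  have h1 := delB_length' (seg C k)
  rw [hk, seg_length', seg_length'] at h1
  have h2 := delB_prefix' (seg_prefix' C (show m ≤ k by omega))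
  rw [hk] at h2
  exact eq_seg_of_prefix' h2

theorem eq_seg_C (hC : C ∈ paths {τ : List Sym3 | TreeT σs τ})
    (hCd : ∀ n : ℕ, ∃ k : ℕ, delB (seg C k) = seg A n) {τ : List Sym3} (hτ : TreeT σs τ) :
    delB τ = seg A (delB τ).length → τ = seg C τ.length := by
  induction hτ with
  | nil => intro _; rfl
  | ext τ a h1 h2 ih =>
    intro h
    have hpre : delB τ = seg A (delB τ).length := by
      have : delB τ <+: delB (τ ++ [a]) := delB_prefix' (List.prefix_append _ _)
      rw [h] at this
      exact eq_seg_of_prefix' this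
    have ihh := ih hpre
    have hCs : TreeT σs (seg C τ.length ++ [C τ.length]) := by
      rw [← seg_succ']; exact hC _
    rw [← ihh, treeT_snoc] at hCs
    have hCA := delB_C hCd (τ.length + 1)
    rw [seg_succ', ← ihh] at hCA
    rw [List.length_append, List.length_singleton, seg_succ', ← ihh]
    have h3 := hCs.2
    congr 2
    by_cases hb : delB τ <+: σs (stg σs τ.length)
    · rw [if_pos hb] at h2 h3
      rcases a with _ | a
      · exact absurd rfl h2
      rcases hc : C τ.length with _ | c
      · exact absurd hc h3
      rw [hc] at hCA
      rw [delB_append'] at h hCA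
      have e1 : ∀ x : Bool, delB [some x] = [x] := fun x => rfl
      rw [e1] at h hCA
      simp only [List.length_append, List.length_singleton] at h hCA
      have := List.append_cancel_left (h.trans hCA.symm)
      simpa using this
    · rw [if_neg hb] at h2 h3
      rw [h2, h3]

/-- Past some level, the strings whose deletion does not extend `A` up to `k` never branch. -/
theorem nonbranch (happ : RecApprox σs A) (hC : C ∈ paths {τ : List Sym3 | TreeT σs τ})
    (hCd : ∀ n : ℕ, ∃ k : ℕ, delB (seg C k) = seg A n) (k : ℕ) :
    ∃ M, k ≤ M ∧ ∀ τ, TreeT σs τ → M ≤ τ.length → ¬ seg A k <+: delB τ →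
      ¬ delB τ <+: σs (stg σs τ.length) := by
  obtain ⟨s0, hs0⟩ := happ.2 k
  obtain ⟨M1, hM1⟩ := stg_large σs s0
  obtain ⟨M2, hM2⟩ := hCd k
  refine ⟨max k (max M1 M2), le_max_left _ _, fun τ hτ hl hn hb => ?_⟩
  have h1 : seg A k <+: σs (stg σs τ.length) := by
    rw [← hs0 _ (hM1 τ.length (by omega))]; exact List.take_prefix _ _
  rcases List.prefix_or_prefix_of_prefix h1 hb with h | h
  · exact hn h
  · have := eq_seg_C hC hCd hτ (eq_seg_of_prefix' h)
    apply hn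
    rw [← hM2, this]
    exact delB_prefix' (seg_prefix' C (by omega))

theorem path_eq {k M : ℕ} (hM : ∀ τ, TreeT σs τ → M ≤ τ.length → ¬ seg A k <+: delB τ →
      ¬ delB τ <+: σs (stg σs τ.length))
    {X Y : ℕ → Sym3} (hX : X ∈ paths {τ : List Sym3 | TreeT σs τ})
    (hY : Y ∈ paths {τ : List Sym3 | TreeT σs τ}) (hXY : seg X M = seg Y M)
    (hn : ¬ seg A k <+: delB (seg X M)) : X = Y := by
  have key : ∀ {X : ℕ → Sym3}, X ∈ paths {τ : List Sym3 | TreeT σs τ} →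
      ¬ seg A k <+: delB (seg X M) → ∀ n ≥ M, delB (seg X n) = delB (seg X M) ∧ X n = none := by
    intro X hX hn n hMn
    have step : ∀ n ≥ M, delB (seg X n) = delB (seg X M) → X n = none := by
      intro n hMn he
      have h1 : TreeT σs (seg X n ++ [X n]) := by rw [← seg_succ']; exact hX _
      have h2 := ((treeT_snoc _ _ _).1 h1).2
      rwa [if_neg (hM _ (hX n) (by rw [seg_length']; exact hMn) (by rwa [he]))] at h2
    have e : delB (seg X n) = delB (seg X M) := by
      induction n, hMn using Nat.le_induction with
      | base => rfl
      | succ n hMn ih =>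
        rw [seg_succ', delB_append', step n hMn ih, ih]; simp [delB]
    exact ⟨e, step n hMn e⟩
  funext n
  by_cases h : n < M
  · exact seg_inj' hXY h
  · rw [(key hX hn n (by omega)).2, (key hY (by rwa [← hXY]) n (by omega)).2]

theorem finite_off {k M : ℕ} (hM : ∀ τ, TreeT σs τ → M ≤ τ.length → ¬ seg A k <+: delB τ →
      ¬ delB τ <+: σs (stg σs τ.length)) :
    {X ∈ paths {τ : List Sym3 | TreeT σs τ} | ¬ seg A k <+: delB (seg X M)}.Finite := by
  refine Set.Finite.of_finite_image (f := fun X => seg X M) ?_ ?_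
  · refine (List.finite_length_eq Sym3 M).subset ?_
    rintro _ ⟨X, _, rfl⟩
    exact seg_length' _ _
  · intro X hX Y hY h
    exact path_eq hM hX.1 hY.1 h hX.2

/-- The avoidance level for a recursive tree `U` containing `C`. -/
theorem avoid_level (hA : OneGeneric A) (hT : RecTree {τ : List Sym3 | TreeT σs τ})
    (hC : C ∈ paths {τ : List Sym3 | TreeT σs τ})
    (hCd : ∀ n : ℕ, ∃ k : ℕ, delB (seg C k) = seg A n)
    {U : Set (List Sym3)} (hU : RecTree U) (hCU : C ∈ paths U) :
    ∃ k, ∀ τ, TreeT σs τ → τ ∉ U → ¬ seg A k <+: delB τ := by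
  rcases hA _ (sigma01_diff hT hU) with ⟨k, τ, h1, h2, h3⟩ | ⟨k, hk⟩
  · exfalso
    have := eq_seg_C hC hCd h1 (by rw [h3, seg_length'])
    apply h2
    rw [this]; exact hCU _
  · exact ⟨k, fun τ h1 h2 h3 => hk _ h3 ⟨τ, h1, h2, rfl⟩⟩

theorem off_of_notMem {U : Set (List Sym3)} (hU : IsTree U) {k M : ℕ}
    (hk : ∀ τ, TreeT σs τ → τ ∉ U → ¬ seg A k <+: delB τ)
    {X : ℕ → Sym3} (hX : X ∈ paths {τ : List Sym3 | TreeT σs τ}) (hXU : X ∉ paths U) :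
    ¬ seg A k <+: delB (seg X M) := by
  intro h
  apply hXU
  intro n
  by_contra hn
  refine hk (seg X (max n M)) (hX _) (fun h' => hn (hU _ _ (seg_prefix' X (le_max_left _ _)) h')) ?_
  exact h.trans (delB_prefix' (seg_prefix' X (le_max_right _ _)))

theorem core (hA : OneGeneric A) (happ : RecApprox σs A)
    (hinc : ∀ s, (σs s).length < (σs (s + 1)).length)
    (hC : C ∈ paths {τ : List Sym3 | TreeT σs τ})
    (hCd : ∀ n : ℕ, ∃ k : ℕ, delB (seg C k) = seg A n)
    (U : Set (List Sym3)) (hU : RecTree U) (hUT : U ⊆ {τ : List Sym3 | TreeT σs τ})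
    (hCU : C ∈ paths U) :
    {s : ℕ | ∃ τ : List Sym3, TreeT σs τ ∧ τ ∉ U ∧ delB τ = σs s}.Finite ∧
    (paths {τ : List Sym3 | TreeT σs τ} \ paths U).Finite ∧
    (∃ N : Set (ℕ → Sym3), ClopenC N ∧
        paths U = paths {τ : List Sym3 | TreeT σs τ} ∩ N) := by
  have hT := treeT_rec σs happ.1 hinc
  obtain ⟨k, hk⟩ := avoid_level hA hT hC hCd hU hCU
  obtain ⟨M, -, hM⟩ := nonbranch happ hC hCd k
  refine ⟨?_, ?_, ?_⟩
  · obtain ⟨s0, hs0⟩ := happ.2 k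
    refine (Set.finite_lt_nat s0).subset ?_
    rintro s ⟨τ, h1, h2, h3⟩
    by_contra hs
    refine hk τ h1 h2 ?_
    rw [h3, ← hs0 s (not_lt.1 hs)]
    exact List.take_prefix _ _
  · exact (finite_off hM).subset fun X hX => ⟨hX.1, off_of_notMem hU.1 hk hX.1 hX.2⟩
  · refine clopen_of_level _ _ (fun X hX n => hUT (hX n)) M ?_
    intro X hX Y hY h hXU
    by_contra hYU
    have := path_eq hM hY hX h.symm (off_of_notMem hU.1 hk hY hYU)
    exact hYU (this ▸ hXU)

theorem thin_core (hA : OneGeneric A) (happ : RecApprox σs A)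
    (hinc : ∀ s, (σs s).length < (σs (s + 1)).length)
    (hC : C ∈ paths {τ : List Sym3 | TreeT σs τ})
    (hCd : ∀ n : ℕ, ∃ k : ℕ, delB (seg C k) = seg A n) :
    ThinPi01 (paths {τ : List Sym3 | TreeT σs τ}) := by
  have hT := treeT_rec σs happ.1 hinc
  refine ⟨⟨_, hT, rfl⟩, ?_⟩
  rintro Q ⟨T', hT', rfl⟩ hQ
  by_cases hCQ : C ∈ paths T'
  · have he : paths T' = paths ({τ : List Sym3 | TreeT σs τ} ∩ T') :=
      Set.Subset.antisymm (fun X hX n => ⟨hQ hX n, hX n⟩) (fun X hX n => (hX n).2)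
    obtain ⟨-, -, h⟩ := core hA happ hinc hC hCd _ (recTree_inter hT hT')
      Set.inter_subset_left (fun n => ⟨hC n, hCQ n⟩)
    rwa [← he] at h
  · have : ∃ m, seg C m ∉ T' := by
      by_contra! h
      exact hCQ h
    obtain ⟨m, hm⟩ := this
    obtain ⟨M, hmM, hM⟩ := nonbranch happ hC hCd m
    refine clopen_of_level _ _ hQ M ?_
    intro X hX Y hY h hXQ
    have hn : ¬ seg A m <+: delB (seg X M) := by
      intro hp
      have h1 : delB (seg X m) <+: delB (seg X M) := delB_prefix' (seg_prefix' X hmM)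
      have h2 : delB (seg X m) <+: seg A m := by
        refine List.prefix_of_prefix_length_le h1 hp ?_
        have := delB_length' (seg X m)
        rw [seg_length'] at this ⊢
        exact this
      have h3 := eq_seg_C hC hCd (hX m) (eq_seg_of_prefix' h2)
      rw [seg_length'] at h3
      exact hm (h3 ▸ hXQ m)
    exact path_eq hM hX hY h hn ▸ hXQ

end main

/-- for the constructed tree `T` with distinguished path `C`, if `U` is a
recursive subtree of `T` with `C ∈ [U]`, then `V = {s : ∃ τ ∈ T \ U, τ^d = σ_s}` is
finite, `[T] \ [U]` is finite, and `[U] = [T] ∩ N` for some clopen `N`; hence `[T]` is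
a thin Π⁰₁ class. -/
theorem treeT_subtree_with_C_and_thin (A : ℕ → Bool) (σs : ℕ → BStr) (hA : OneGeneric A)
    (hle : TuringLE A K) (hlt : ¬ TuringLE K A)
    (happ : RecApprox σs A) (hcor : SigmaOneCorrect σs A)
    (hinc : ∀ s, (σs s).length < (σs (s + 1)).length)
    (C : ℕ → Sym3) (hC : C ∈ paths {τ : List Sym3 | TreeT σs τ})
    (hCinf : {n : ℕ | C n ≠ none}.Infinite)
    (hCd : ∀ n : ℕ, ∃ k : ℕ, delB (seg C k) = seg A n)
    (U : Set (List Sym3)) (hU : RecTree U) (hUT : U ⊆ {τ : List Sym3 | TreeT σs τ})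
    (hCU : C ∈ paths U) :
    {s : ℕ | ∃ τ : List Sym3, TreeT σs τ ∧ τ ∉ U ∧ delB τ = σs s}.Finite ∧
    (paths {τ : List Sym3 | TreeT σs τ} \ paths U).Finite ∧
    (∃ N : Set (ℕ → Sym3), ClopenC N ∧
        paths U = paths {τ : List Sym3 | TreeT σs τ} ∩ N) ∧
    ThinPi01 (paths {τ : List Sym3 | TreeT σs τ}) := by
  obtain ⟨h1, h2, h3⟩ := core hA happ hinc hC hCd U hU hUT hCU
  exact ⟨h1, h2, h3, thin_core hA happ hinc hC hCd⟩
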